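/- Let G be a graph with K vertices (given by a symmetric 0-1 adjacency matrix) and let 1 ≤ N ≤ K. Then λ_N^1(G) ≤ θ_N(G) − Nμ(G), i.e., the N-particle Bose–Hubbard ground energy of G (shifted by Nμ(G)) is at most the ground energy of the XY Hamiltonian of G in the magnetization-N sector (shifted by Nμ(G)). -/

import Mathlib

namespace BH

variable {V : Type*} [Fintype V] [DecidableEq V]

/-- The operator `M` acting on the `w`-th factor of the `N`-fold tensor power
`(ℂ^V)^{⊗N}`, the latter identified with `ℂ^{V^N}`. -/
noncomputable def onFactor (N : ℕ) (M : Matrix V V ℂ) (w : Fin N) :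
    Matrix (Fin N → V) (Fin N → V) ℂ :=
  Matrix.of fun x y =>
    (if ∀ u, u ≠ w → x u = y u then (1 : ℂ) else 0) * M (x w) (y w)

/-- The Bose–Hubbard interaction term
`Σ_{k ∈ V} Σ_{w ≠ w'} (|k⟩⟨k|)^{(w)} (|k⟩⟨k|)^{(w')}`, a diagonal matrix whose diagonal
entry at a configuration `x : Fin N → V` counts the ordered pairs of distinct particles
sitting at a common vertex. -/
noncomputable def interaction (V : Type*) [DecidableEq V] (N : ℕ) :
    Matrix (Fin N → V) (Fin N → V) ℂ :=
  Matrix.of fun x y =>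
    if x = y then
      (((Finset.univ : Finset (Fin N × Fin N)).filter
          fun p => p.1 ≠ p.2 ∧ x p.1 = x p.2).card : ℂ)
    else 0

/-- The `N`-particle Bose–Hubbard Hamiltonian `H_G^N` (with hopping and interaction
strengths equal to `1`) for the graph with adjacency matrix `A`. -/
noncomputable def bhHam (A : Matrix V V ℂ) (N : ℕ) :
    Matrix (Fin N → V) (Fin N → V) ℂ :=
  (∑ w : Fin N, onFactor N A w) + interaction V N

/-- The bosonic (symmetric) subspace `Z_N(G)`: states invariant under every permutation
of the `N` tensor factors. -/
def symmStates (V : Type*) (N : ℕ) : Set ((Fin N → V) → ℂ) :=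
  { ψ | ∀ σ : Equiv.Perm (Fin N), ∀ x : Fin N → V, ψ (x ∘ σ) = ψ x }

/-- The ground energy (smallest eigenvalue) of the compression of a Hermitian matrix `H`
to a subspace given as a set `Z` of states: the infimum of the Rayleigh quotients
`⟨ψ, H ψ⟩` over unit vectors `ψ ∈ Z`. -/
noncomputable def groundEnergy {ι : Type*} [Fintype ι]
    (H : Matrix ι ι ℂ) (Z : Set (ι → ℂ)) : ℝ :=
  sInf { r : ℝ | ∃ ψ ∈ Z, dotProduct (star ψ) ψ = 1 ∧
    r = (dotProduct (star ψ) (H.mulVec ψ)).re }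

/-- `μ(G)`: the smallest eigenvalue of the adjacency matrix `A = A(G)`. -/
noncomputable def mu (A : Matrix V V ℂ) : ℝ :=
  groundEnergy A Set.univ

/-- `λ_N^1(G)`: the smallest eigenvalue of `H(G,N)`, the restriction of
`H_G^N − N μ(G)·1` to the symmetric subspace `Z_N(G)`. -/
noncomputable def lambda1 (A : Matrix V V ℂ) (N : ℕ) : ℝ :=
  groundEnergy (bhHam A N - ((N : ℂ) * (mu A : ℂ)) • 1) (symmStates V N)

end BH

namespace BH

open scoped Classical

variable {V : Type*} [Fintype V] [DecidableEq V]

/-- The hopping term `|01⟩⟨10| + |10⟩⟨01|` on the pair of qubits `(i,j)` (in one ordered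
orientation; summing over both ordered pairs `(i,j)` and `(j,i)` yields the full
symmetric hopping term of the unordered pair `{i,j}`). -/
noncomputable def xyHop (V : Type*) [DecidableEq V] (i j : V) :
    Matrix (V → Fin 2) (V → Fin 2) ℂ :=
  Matrix.of fun x y =>
    if x i = 1 ∧ x j = 0 ∧ y i = 0 ∧ y j = 1 ∧ (∀ u, u ≠ i → u ≠ j → x u = y u)
    then 1 else 0

/-- The XY Hamiltonian
`O_G = Σ_{{i,j} : i≠j, A i j = 1} (|01⟩⟨10| + |10⟩⟨01|)_{ij} + Σ_{i : A i i = 1} (|1⟩⟨1|)_i`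
on the `V`-qubit space `(ℂ²)^{⊗V}`. -/
noncomputable def xyHam (A : Matrix V V ℂ) : Matrix (V → Fin 2) (V → Fin 2) ℂ :=
  (∑ p : V × V, if p.1 ≠ p.2 ∧ A p.1 p.2 = 1 then xyHop V p.1 p.2 else 0)
    + Matrix.of fun x y =>
        if x = y then
          ((Finset.univ.filter fun i : V => A i i = 1 ∧ x i = 1).card : ℂ)
        else 0

/-- The magnetization-`N` sector `Wt_N(G)`: the span of the computational basis states
with exactly `N` qubits in state `|1⟩`. -/
def wtStates (V : Type*) [Fintype V] [DecidableEq V] (N : ℕ) :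
    Set ((V → Fin 2) → ℂ) :=
  { ψ | ∀ x : V → Fin 2, (Finset.univ.filter fun i => x i = 1).card ≠ N → ψ x = 0 }

/-- `θ_N(G)`: the smallest eigenvalue of the XY Hamiltonian `O_G` restricted to the
magnetization-`N` sector. -/
noncomputable def theta (A : Matrix V V ℂ) (N : ℕ) : ℝ :=
  groundEnergy (xyHam A) (wtStates V N)

end BH

namespace BH

open scoped Classical

section helpers

/-- The occupation pattern of a configuration. -/
noncomputable def occ {V : Type*} {N : ℕ} (x : Fin N → V) : V → Fin 2 :=
  fun v => if ∃ w, x w = v then 1 else 0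

theorem occ_eq_one {V : Type*} {N : ℕ} (x : Fin N → V) (v : V) :
    occ x v = 1 ↔ ∃ w, x w = v := by
  unfold occ; split_ifs with h <;> simp [h]

theorem occ_eq_zero {V : Type*} {N : ℕ} (x : Fin N → V) (v : V) :
    occ x v = 0 ↔ ¬ ∃ w, x w = v := by
  unfold occ; split_ifs with h <;> simp [h]

theorem fin2_ext (a b : Fin 2) (h : a = 1 ↔ b = 1) : a = b := by
  revert h; revert a b; decide

variable {V : Type*} [Fintype V] [DecidableEq V]

theorem wt_occ {N : ℕ} (x : Fin N → V) (hx : Function.Injective x) :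
    (Finset.univ.filter fun i => occ x i = 1).card = N := by
  have : (Finset.univ.filter fun i => occ x i = 1) = Finset.univ.image x := by
    ext v; simp [occ_eq_one]
  rw [this, Finset.card_image_of_injective _ hx]; simp

theorem card_fiber (N : ℕ) (s : V → Fin 2)
    (hs : (Finset.univ.filter fun i => s i = 1).card = N) :
    ((Finset.univ.filter fun x : Fin N → V => Function.Injective x).filter
      fun x => occ x = s).card = N.factorial := by
  have hc : Fintype.card {v // s v = 1} = N := by
    rw [Fintype.card_subtype]; convert hs
  have e : Fin N ≃ {v // s v = 1} := (Fintype.equivFinOfCardEq hc).symm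
  have h := Fintype.card_equiv e
  rw [Fintype.card_fin] at h
  rw [← h, ← Finset.card_univ]
  symm
  refine Finset.card_bij (fun e _ => fun w => (e w).1) ?_ ?_ ?_
  · intro e _
    simp only [Finset.mem_filter, Finset.mem_univ, true_and]
    refine ⟨Subtype.val_injective.comp e.injective, ?_⟩
    funext v
    apply fin2_ext
    rw [occ_eq_one]
    constructor
    · rintro ⟨w, rfl⟩; exact (e w).2
    · intro hv; exact ⟨e.symm ⟨v, hv⟩, by simp⟩
  · intro e _ e' _ hee
    ext w
    exact congrFun hee w
  · intro x hx
    simp only [Finset.mem_filter, Finset.mem_univ, true_and] at hx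
    obtain ⟨hi, ho⟩ := hx
    have hm : ∀ w, s (x w) = 1 := fun w => by rw [← ho, occ_eq_one]; exact ⟨w, rfl⟩
    refine ⟨Equiv.ofBijective (fun w => ⟨x w, hm w⟩) ⟨?_, ?_⟩, Finset.mem_univ _, ?_⟩
    · intro a b hab; exact hi (congrArg Subtype.val hab)
    · rintro ⟨v, hv⟩
      rw [← ho, occ_eq_one] at hv
      obtain ⟨w, hw⟩ := hv
      exact ⟨w, Subtype.ext hw⟩
    · rfl

theorem sum_occ (N : ℕ) (F : (V → Fin 2) → ℂ)
    (hF : ∀ s : V → Fin 2, (Finset.univ.filter fun i => s i = 1).card ≠ N → F s = 0) :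
    ∑ x : Fin N → V, (if Function.Injective x then F (occ x) else 0)
      = (N.factorial : ℂ) * ∑ s, F s := by
  rw [← Finset.sum_filter, ← Finset.sum_fiberwise (g := occ), Finset.mul_sum]
  refine Finset.sum_congr rfl fun s _ => ?_
  rw [Finset.sum_congr rfl (g := fun _ => F s), Finset.sum_const, nsmul_eq_mul]
  · by_cases hs : (Finset.univ.filter fun i => s i = 1).card = N
    · rw [card_fiber N s hs]
    · rw [hF s hs]; simp
  · intro x hx
    rw [(Finset.mem_filter.1 hx).2]

theorem rayleigh_bdd {ι : Type*} [Fintype ι] (H : Matrix ι ι ℂ) (Z : Set (ι → ℂ)) :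
    BddBelow { r : ℝ | ∃ ψ ∈ Z, dotProduct (star ψ) ψ = 1 ∧
      r = (dotProduct (star ψ) (H.mulVec ψ)).re } := by
  refine ⟨-∑ i, ∑ j, ‖H i j‖, ?_⟩
  rintro r ⟨ψ, -, h1, rfl⟩
  have hn : ∑ i, ‖ψ i‖ ^ 2 = 1 := by
    have := congrArg Complex.re h1
    simp only [dotProduct, Pi.star_apply, Complex.re_sum] at this
    simpa [Complex.sq_norm, Complex.normSq_apply] using this
  have hb : ∀ i, ‖ψ i‖ ≤ 1 := by
    intro i
    have := Finset.single_le_sum (f := fun i => ‖ψ i‖ ^ 2) (fun i _ => by positivity)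
      (Finset.mem_univ i)
    simp only [hn] at this
    nlinarith [norm_nonneg (ψ i)]
  have key : ‖dotProduct (star ψ) (H.mulVec ψ)‖ ≤ ∑ i, ∑ j, ‖H i j‖ := by
    unfold dotProduct Matrix.mulVec dotProduct
    refine (norm_sum_le _ _).trans (Finset.sum_le_sum fun i _ => ?_)
    rw [norm_mul, Pi.star_apply, norm_star]
    calc ‖ψ i‖ * ‖∑ j, H i j * ψ j‖ ≤ 1 * ‖∑ j, H i j * ψ j‖ := by
          gcongr; exact hb i
      _ ≤ ∑ j, ‖H i j * ψ j‖ := by rw [one_mul]; exact norm_sum_le _ _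
      _ ≤ _ := by
          refine Finset.sum_le_sum fun j _ => ?_
          rw [norm_mul]
          exact mul_le_of_le_one_right (norm_nonneg _) (hb j)
  have := (abs_le.1 ((Complex.abs_re_le_norm _).trans key)).1
  exact this

theorem onFactor_mulVec (N : ℕ) (A : Matrix V V ℂ) (w : Fin N) (ψ : (Fin N → V) → ℂ)
    (x : Fin N → V) :
    (onFactor N A w).mulVec ψ x = ∑ k, A (x w) k * ψ (Function.update x w k) := by
  simp only [Matrix.mulVec, dotProduct, onFactor, Matrix.of_apply, ite_mul, one_mul, zero_mul]
  rw [← Finset.sum_filter]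
  symm
  refine Finset.sum_bij (fun k _ => Function.update x w k) ?_ ?_ ?_ ?_
  · intro k _
    simp only [Finset.mem_filter, Finset.mem_univ, true_and]
    intro u hu; simp [hu]
  · intro a _ b _ hab
    simpa using congrFun hab w
  · intro y hy
    simp only [Finset.mem_filter, Finset.mem_univ, true_and] at hy
    refine ⟨y w, Finset.mem_univ _, ?_⟩
    funext u
    by_cases hu : u = w
    · subst hu; simp
    · simp [hu, hy u hu]
  · intro k _; simp

theorem interaction_mulVec (N : ℕ) (ψ : (Fin N → V) → ℂ)
    (x : Fin N → V) (hx : Function.Injective x) :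
    (interaction V N).mulVec ψ x = 0 := by
  simp only [Matrix.mulVec, dotProduct, interaction, Matrix.of_apply]
  refine Finset.sum_eq_zero fun y _ => ?_
  have : ((Finset.univ : Finset (Fin N × Fin N)).filter
          fun p => p.1 ≠ p.2 ∧ x p.1 = x p.2) = ∅ := by
    ext p; simp; intro h h'; exact h (hx h')
  rw [this]; simp

theorem xyHop_mulVec (i j : V) (hij : i ≠ j) (φ : (V → Fin 2) → ℂ) (s : V → Fin 2) :
    (xyHop V i j).mulVec φ s =
      if s i = 1 ∧ s j = 0 then φ (Function.update (Function.update s i 0) j 1) else 0 := by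
  simp only [Matrix.mulVec, dotProduct, xyHop, Matrix.of_apply]
  split_ifs with h
  · rw [Finset.sum_eq_single (Function.update (Function.update s i 0) j 1)]
    · rw [if_pos, one_mul]
      refine ⟨h.1, h.2, by simp [hij], by simp, ?_⟩
      intro u hi hj; simp [hi, hj]
    · intro y _ hy
      rw [if_neg, zero_mul]
      rintro ⟨-, -, h1, h2, h3⟩
      apply hy
      funext u
      by_cases hj : u = j
      · subst hj; simp [h2]
      · by_cases hi : u = i
        · subst hi; simp [hj, h1]
        · simp [hi, hj, h3 u hi hj]
    · simp
  · refine Finset.sum_eq_zero fun y _ => ?_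
    rw [if_neg, zero_mul]
    rintro ⟨h1, h2, -⟩
    exact h ⟨h1, h2⟩

theorem xyHam_mulVec (A : Matrix V V ℂ) (h01 : ∀ i j, A i j = 0 ∨ A i j = 1)
    (φ : (V → Fin 2) → ℂ) (s : V → Fin 2) :
    (xyHam A).mulVec φ s = ∑ i, if s i = 1 then
      (A i i * φ s + ∑ j, if s j = 0 then
        A i j * φ (Function.update (Function.update s i 0) j 1) else 0) else 0 := by
  rw [xyHam, Matrix.add_mulVec, Pi.add_apply, Matrix.sum_mulVec, Finset.sum_apply]
  have h1 : (Matrix.mulVec (Matrix.of fun x y : V → Fin 2 =>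
        if x = y then
          ((Finset.univ.filter fun i : V => A i i = 1 ∧ x i = 1).card : ℂ)
        else 0) φ) s = ∑ i, if s i = 1 then A i i * φ s else 0 := by
    simp only [Matrix.mulVec, dotProduct, Matrix.of_apply, ite_mul, zero_mul]
    rw [Finset.sum_ite_eq]
    simp only [Finset.mem_univ, if_true, Finset.card_filter]
    push_cast
    rw [Finset.sum_mul]
    refine Finset.sum_congr rfl fun i _ => ?_
    rcases h01 i i with h | h <;> by_cases hs : s i = 1 <;> simp [h, hs]
  rw [h1, add_comm, Fintype.sum_prod_type, ← Finset.sum_add_distrib]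
  refine Finset.sum_congr rfl fun i _ => ?_
  have h2 : ∀ j, (Matrix.mulVec (if i ≠ j ∧ A i j = 1 then xyHop V i j else 0) φ) s
      = if s i = 1 then (if s j = 0 then
        A i j * φ (Function.update (Function.update s i 0) j 1) else 0) else 0 := by
    intro j
    by_cases hij : i = j
    · subst hij
      by_cases hs : s i = 1 <;> simp [hs]
    · rcases h01 i j with h | h
      · simp [h]
      · simp only [ne_eq, hij, not_false_eq_true, h, and_self, if_true]
        rw [xyHop_mulVec i j hij]
        split_ifs <;> simp_all
  simp only [h2]
  split_ifs <;> simp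

/-- The bosonic state attached to a qubit state. -/
noncomputable def lift (N : ℕ) (c : ℂ) (φ : (V → Fin 2) → ℂ) : (Fin N → V) → ℂ :=
  fun x => if Function.Injective x then c * φ (occ x) else 0

theorem occ_update {N : ℕ} (x : Fin N → V) (hx : Function.Injective x) (w : Fin N) (k : V)
    (hk : ¬ ∃ u, x u = k) :
    occ (Function.update x w k) = Function.update (Function.update (occ x) (x w) 0) k 1 := by
  funext v
  apply fin2_ext
  rw [occ_eq_one]
  by_cases hv : v = k
  · subst hv; simp only [Function.update_self, iff_true]; exact ⟨w, by simp⟩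
  · by_cases hw : v = x w
    · subst hw
      simp only [Function.update_of_ne hv, Function.update_self]
      simp only [zero_ne_one, iff_false]
      rintro ⟨u, hu⟩
      by_cases huw : u = w
      · subst huw; simp at hu; exact hv hu.symm
      · rw [Function.update_of_ne huw] at hu; exact huw (hx hu)
    · rw [Function.update_of_ne hv, Function.update_of_ne hw, occ_eq_one]
      constructor
      · rintro ⟨u, hu⟩
        by_cases huw : u = w
        · subst huw; simp at hu; exact absurd hu.symm hv
        · rw [Function.update_of_ne huw] at hu; exact ⟨u, hu⟩
      · rintro ⟨u, hu⟩
        refine ⟨u, ?_⟩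
        rw [Function.update_of_ne, hu]
        rintro rfl; exact hw hu.symm

theorem inj_update {N : ℕ} (x : Fin N → V) (hx : Function.Injective x) (w : Fin N) (k : V)
    (hk : ¬ ∃ u, x u = k) : Function.Injective (Function.update x w k) := by
  intro a b hab
  by_cases ha : a = w <;> by_cases hb : b = w
  · rw [ha, hb]
  · subst ha; rw [Function.update_self, Function.update_of_ne hb] at hab
    exact absurd ⟨b, hab.symm⟩ hk
  · subst hb; rw [Function.update_self, Function.update_of_ne ha] at hab
    exact absurd ⟨a, hab⟩ hk
  · rw [Function.update_of_ne ha, Function.update_of_ne hb] at hab; exact hx hab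

theorem not_inj_update {N : ℕ} (x : Fin N → V) (w : Fin N) (k : V)
    (hk : ∃ u, x u = k) (hkw : k ≠ x w) : ¬ Function.Injective (Function.update x w k) := by
  intro h
  obtain ⟨u, rfl⟩ := hk
  have huw : u ≠ w := by rintro rfl; exact hkw rfl
  exact huw (h (by rw [Function.update_of_ne huw, Function.update_self]))

theorem bhHam_lift (A : Matrix V V ℂ) (h01 : ∀ i j, A i j = 0 ∨ A i j = 1) (N : ℕ) (c : ℂ)
    (φ : (V → Fin 2) → ℂ) (x : Fin N → V) (hx : Function.Injective x) :
    (bhHam A N).mulVec (lift N c φ) x = c * (xyHam A).mulVec φ (occ x) := by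
  rw [bhHam, Matrix.add_mulVec, Pi.add_apply, interaction_mulVec N _ x hx, add_zero,
    Matrix.sum_mulVec, Finset.sum_apply, xyHam_mulVec A h01, ← Finset.sum_filter]
  have : (Finset.univ.filter fun i => occ x i = 1) = Finset.univ.image x := by
    ext v; simp [occ_eq_one]
  rw [this, Finset.sum_image (fun a _ b _ h => hx h), Finset.mul_sum]
  refine Finset.sum_congr rfl fun w _ => ?_
  rw [onFactor_mulVec]
  have hA : A (x w) (x w) * φ (occ x) = ∑ k, if k = x w then A (x w) k * φ (occ x) else 0 := by
    simp
  rw [hA, ← Finset.sum_add_distrib, Finset.mul_sum]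
  refine Finset.sum_congr rfl fun k _ => ?_
  by_cases hk : ∃ u, x u = k
  · have h0 : ¬ occ x k = 0 := by rw [occ_eq_zero]; simpa using hk
    rw [if_neg h0, add_zero]
    by_cases hkw : k = x w
    · subst hkw
      rw [Function.update_eq_self]; simp [lift, hx]; ring
    · simp [lift, not_inj_update x w k hk hkw, hkw]
  · have h0 : occ x k = 0 := by rw [occ_eq_zero]; exact hk
    have hkw : k ≠ x w := fun h => hk ⟨w, h.symm⟩
    rw [if_pos h0, if_neg hkw, zero_add, lift, if_pos (inj_update x hx w k hk),
      occ_update x hx w k hk]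
    ring

theorem lift_inner (N : ℕ) (φ χ : (V → Fin 2) → ℂ) (χ' : (Fin N → V) → ℂ) (c : ℝ)
    (hc : c * c * (N.factorial : ℝ) = 1) (hφ : φ ∈ wtStates V N)
    (h : ∀ x, Function.Injective x → χ' x = c * χ (occ x)) :
    dotProduct (star (lift N c φ)) χ' = dotProduct (star φ) χ := by
  have h1 := sum_occ (V := V) N (fun s => (c * c : ℂ) * (star (φ s) * χ s)) (by
    intro s hs
    have : φ s = 0 := hφ s (by convert hs)
    simp [this])
  have hc' : (c * c * (N.factorial : ℂ)) = 1 := by exact_mod_cast hc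
  rw [← Finset.mul_sum, ← mul_assoc, mul_comm (N.factorial : ℂ), hc', one_mul] at h1
  unfold dotProduct
  simp only [Pi.star_apply]
  rw [← h1]
  refine Finset.sum_congr rfl fun x _ => ?_
  by_cases hx : Function.Injective x
  · rw [h x hx]; simp [lift, hx]; ring
  · simp [lift, hx]

theorem lift_symm (N : ℕ) (c : ℂ) (φ : (V → Fin 2) → ℂ) : lift N c φ ∈ symmStates V N := by
  intro σ x
  have h1 : Function.Injective (x ∘ σ) ↔ Function.Injective x := σ.injective_comp x
  have h2 : occ (x ∘ σ) = occ x := by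
    funext v; apply fin2_ext; rw [occ_eq_one, occ_eq_one]
    exact (σ.surjective.exists (p := fun w => x w = v)).symm
  simp only [lift, h1, h2]

theorem theta_nonempty (A : Matrix V V ℂ) (N : ℕ) (hNK : N ≤ Fintype.card V) :
    { r : ℝ | ∃ ψ ∈ wtStates V N, dotProduct (star ψ) ψ = 1 ∧
      r = (dotProduct (star ψ) ((xyHam A).mulVec ψ)).re }.Nonempty := by
  obtain ⟨S, -, hS⟩ := Finset.exists_subset_card_eq (s := (Finset.univ : Finset V))
    (n := N) (by rwa [Finset.card_univ])
  refine ⟨_, Pi.single (fun v => if v ∈ S then 1 else 0) 1, ?_, ?_, rfl⟩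
  · intro x hx
    apply Pi.single_eq_of_ne
    rintro rfl
    apply hx
    simpa using hS
  · simp [dotProduct, Pi.single_apply]

end helpers

end BH

/-- Let `G` be a graph with `K` vertices (given by a symmetric 0-1
adjacency matrix) and let `1 ≤ N ≤ K`.  Then `λ_N^1(G) ≤ θ_N(G) − Nμ(G)`: the
`N`-particle Bose–Hubbard ground energy of `G` (shifted by `Nμ(G)`) is at most the ground
energy of the XY Hamiltonian of `G` in the magnetization-`N` sector (shifted by
`Nμ(G)`). -/
theorem bh_le_xy
    {V : Type*} [Fintype V] [DecidableEq V] [Nonempty V]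
    (A : Matrix V V ℂ) (hsymm : A.IsSymm)
    (h01 : ∀ i j, A i j = 0 ∨ A i j = 1)
    (N : ℕ) (hN1 : 1 ≤ N) (hNK : N ≤ Fintype.card V) :
    BH.lambda1 A N ≤ BH.theta A N - N * BH.mu A := by
  unfold BH.theta
  rw [le_sub_iff_add_le]
  refine le_csInf (BH.theta_nonempty A N hNK) ?_
  rintro r ⟨φ, hφ, h1, rfl⟩
  rw [← le_sub_iff_add_le]
  refine csInf_le (BH.rayleigh_bdd _ _) ?_
  obtain ⟨c, hc⟩ : ∃ c : ℝ, c * c * (N.factorial : ℝ) = 1 := by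
    have hp : (0 : ℝ) < N.factorial := by exact_mod_cast N.factorial_pos
    refine ⟨(Real.sqrt N.factorial)⁻¹, ?_⟩
    rw [← mul_inv, Real.mul_self_sqrt hp.le, inv_mul_cancel₀ hp.ne']
  have hn : dotProduct (star (BH.lift N c φ)) (BH.lift N c φ) = 1 := by
    rw [← h1]
    exact BH.lift_inner N φ φ _ c hc hφ fun x hx => by simp [BH.lift, hx]
  refine ⟨BH.lift N c φ, BH.lift_symm N c φ, hn, ?_⟩
  rw [Matrix.sub_mulVec, Matrix.smul_mulVec, Matrix.one_mulVec, dotProduct_sub,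
    dotProduct_smul, hn,
    BH.lift_inner N φ ((BH.xyHam A).mulVec φ) _ c hc hφ
      (fun x hx => BH.bhHam_lift A h01 N c φ x hx)]
  simp
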